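/- (Minimizers follow the Euler–Lagrange flow, Theorem 3.4(ii).) Let μ_a, μ_b be Borel probability measures on ℝⁿ with compact support that are absolutely continuous with respect to Lebesgue measure. If π ∈ 𝒫(C([a,b];ℝⁿ)) is a minimizer of 𝔸_{μ_a,μ_b} (i.e. 𝔸_{μ_a,μ_b}(π) ≤ 𝔸_{μ_a,μ_b}(π') for all π') with 𝔸_{μ_a,μ_b}(π) < ∞, then there exists a Borel probability measure η on ℝⁿ × ℝⁿ such that π = Φ#η, the pushforward of η under the flow map Φ. -/

import Mathlib

open MeasureTheory Filter Topology
open scoped ENNReal NNReal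

noncomputable section

/-- Euclidean space `ℝⁿ`. -/
abbrev Eu (n : ℕ) := EuclideanSpace ℝ (Fin n)

/-- The space `C([a,b];ℝⁿ)` of continuous curves with the supremum metric. -/
abbrev CPath (a b : ℝ) (n : ℕ) := C(Set.Icc a b, Eu n)

/-- We endow the path space with its Borel σ-algebra. -/
noncomputable instance pathMeasurableSpace (a b : ℝ) (n : ℕ) :
    MeasurableSpace (CPath a b n) := borel _

instance pathBorelSpace (a b : ℝ) (n : ℕ) : BorelSpace (CPath a b n) :=
  ⟨rfl⟩

/-- Evaluation of a curve at time `t ∈ [a,b]` (junk value `0` outside `[a,b]`). -/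
def pev {a b : ℝ} {n : ℕ} (γ : CPath a b n) (t : ℝ) : Eu n :=
  if ht : t ∈ Set.Icc a b then γ ⟨t, ht⟩ else 0

/-- A curve is absolutely continuous if it has a Bochner-integrable derivative `g` with
`γ t = γ s + ∫_s^t g`. -/
def IsACC {a b : ℝ} {n : ℕ} (γ : CPath a b n) : Prop :=
  ∃ g : ℝ → Eu n, IntegrableOn g (Set.Icc a b) ∧
    ∀ s t : Set.Icc a b, γ t = γ s + ∫ u in (s : ℝ)..(t : ℝ), g u

open Classical in
/-- The action `𝒜(γ) = ∫_a^b L(γ(t), γ̇(t)) dt ∈ (−∞,+∞]`, equal to `+∞` on curves that are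
not absolutely continuous (and, by the convention that the integral is `+∞` when the
integrand fails to be integrable -- its negative part being automatically integrable --
also on absolutely continuous curves with non-integrable Lagrangian). -/
def action {n : ℕ} (L : Eu n → Eu n → ℝ) (a b : ℝ) (γ : CPath a b n) : EReal :=
  if h : IsACC γ then
    (if IntegrableOn (fun t => L (pev γ t) (h.choose t)) (Set.Icc a b) then
      (((∫ t in Set.Icc a b, L (pev γ t) (h.choose t)) : ℝ) : EReal)
    else ⊤)
  else ⊤

/-- Positive part of an extended real, as `ℝ≥0∞`. -/
def epos (x : EReal) : ℝ≥0∞ := if x = ⊤ then ⊤ else ENNReal.ofReal x.toReal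

/-- The integral `∫ F dπ ∈ [−∞,+∞]` of an extended-real-valued function, defined as the
difference of the lower integrals of the positive and negative parts. -/
def mint {X : Type*} [MeasurableSpace X] (F : X → EReal) (π : Measure X) : EReal :=
  ((∫⁻ γ, epos (F γ) ∂π : ℝ≥0∞) : EReal) - ((∫⁻ γ, epos (-(F γ)) ∂π : ℝ≥0∞) : EReal)

open Classical in
/-- The constrained functional `𝔸_{μa,μb}(π) = ∫ 𝒜 dπ` if `pr_a#π = μa` and `pr_b#π = μb`,
and `+∞` otherwise, for a given (extended-real-valued) action functional `F`. -/
def aFun {a b : ℝ} {n : ℕ} (F : CPath a b n → EReal) (μa μb : Measure (Eu n))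
    (π : Measure (CPath a b n)) : EReal :=
  if Measure.map (fun γ => pev γ a) π = μa ∧ Measure.map (fun γ => pev γ b) π = μb then
    mint F π
  else ⊤

/-- Weak convergence of a sequence of measures: convergence of the integrals of all bounded
continuous functions. -/
def WeakLim {X : Type*} [TopologicalSpace X] [MeasurableSpace X]
    (πs : ℕ → Measure X) (π : Measure X) : Prop :=
  ∀ φ : BoundedContinuousFunction X ℝ,
    Tendsto (fun N => ∫ x, φ x ∂(πs N)) atTop (𝓝 (∫ x, φ x ∂π))

/-- The empirical measure `(1/N) ∑_{i=1}^N δ_{x i}`. -/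
def emp {X : Type*} [MeasurableSpace X] (N : ℕ) (x : Fin N → X) : Measure X :=
  (N : ℝ≥0∞)⁻¹ • ∑ i : Fin N, Measure.dirac (x i)

/-- The topological support of a measure. -/
def msupp {α : Type*} [TopologicalSpace α] [MeasurableSpace α] (μ : Measure α) : Set α :=
  {x | ∀ U : Set α, IsOpen U → x ∈ U → 0 < μ U}

/-- The set `Γ^min_{K₁,K₂}` of minimizing extremals starting in `K₁` and ending in `K₂`. -/
def GammaMin {n : ℕ} (L : Eu n → Eu n → ℝ) (a b : ℝ) (K₁ K₂ : Set (Eu n)) :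
    Set (CPath a b n) :=
  {γ | IsACC γ ∧ pev γ a ∈ K₁ ∧ pev γ b ∈ K₂ ∧
    ∀ γ' : CPath a b n, IsACC γ' → pev γ' a = pev γ a → pev γ' b = pev γ b →
      action L a b γ ≤ action L a b γ'}

/-- The Lagrangian cost `c(x,y)`: the minimal action among absolutely continuous curves
from `x` to `y`. -/
def cost {n : ℕ} (L : Eu n → Eu n → ℝ) (a b : ℝ) (x y : Eu n) : EReal :=
  ⨅ γ ∈ {γ : CPath a b n | IsACC γ ∧ pev γ a = x ∧ pev γ b = y}, action L a b γ

/-- The restriction of a continuous curve `ℝ → ℝⁿ` to `[a,b]` as an element of the path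
space. -/
def toPath {n : ℕ} (a b : ℝ) (f : ℝ → Eu n) (hf : Continuous f) : CPath a b n :=
  (ContinuousMap.mk f hf).restrict (Set.Icc a b)

/-- `Φ : ℝⁿ × ℝⁿ → C([a,b];ℝⁿ)` is the Euler–Lagrange (Newton) flow map for the Lagrangian
`L(x,v) = (m/2)|v|² − V(x)`: it is continuous and `Φ(x,v)` is a `C²` solution of
`m γ'' = −∇V(γ)` with initial position `x` and initial velocity `v`. -/
def IsNewtonFlow {n : ℕ} (m : ℝ) (V : Eu n → ℝ) (a b : ℝ)
    (Φ : Eu n × Eu n → CPath a b n) : Prop :=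
  Continuous Φ ∧ ∀ x v : Eu n, ∃ f : ℝ → Eu n, ContDiff ℝ 2 f ∧
    (∀ t : Set.Icc a b, Φ (x, v) t = f t) ∧ f a = x ∧ deriv f a = v ∧
    ∀ t ∈ Set.Icc a b, m • deriv (deriv f) t = -gradient V (f t)

/-- The set of `C²` solutions of `m γ'' = −∇V(γ)` starting in `Ka` and ending in `Kb`,
viewed as a subset of the path space. -/
def NewtonSet {n : ℕ} (m : ℝ) (V : Eu n → ℝ) (a b : ℝ) (Ka Kb : Set (Eu n)) :
    Set (CPath a b n) :=
  {γ | ∃ f : ℝ → Eu n, ContDiff ℝ 2 f ∧ (∀ t : Set.Icc a b, γ t = f t) ∧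
    (∀ t ∈ Set.Icc a b, m • deriv (deriv f) t = -gradient V (f t)) ∧
    f a ∈ Ka ∧ f b ∈ Kb}

/-- `γ` is piecewise affine subordinate to the partition `a = τ₀ < … < τ_l = b`. -/
def PiecewiseAffine {n : ℕ} (a b : ℝ) (τ : ℕ → ℝ) (l : ℕ) (γ : CPath a b n) : Prop :=
  ∀ j < l, ∀ t : Set.Icc a b, (t : ℝ) ∈ Set.Icc (τ j) (τ (j + 1)) →
    γ t = pev γ (τ j) + (((t : ℝ) - τ j) / (τ (j + 1) - τ j)) •
      (pev γ (τ (j + 1)) - pev γ (τ j))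

/-- `IsPartition a b τ l h`: `a = τ₀ < τ₁ < … < τ_l = b` is a partition of `[a,b]` of mesh
at most `h`. -/
def IsPartition (a b : ℝ) (τ : ℕ → ℝ) (l : ℕ) (h : ℝ) : Prop :=
  1 ≤ l ∧ τ 0 = a ∧ τ l = b ∧ (∀ j < l, τ j < τ (j + 1)) ∧
    ∀ j < l, τ (j + 1) - τ j ≤ h

/-- The midpoint-rule discrete action, as a (real-valued) sum over the first `l` intervals
of the partition. -/
def dActionSum {n : ℕ} (m : ℝ) (V : Eu n → ℝ) {a b : ℝ} (τ : ℕ → ℝ) (l : ℕ)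
    (γ : CPath a b n) : ℝ :=
  ∑ j ∈ Finset.range l,
    (m / 2 * ‖pev γ (τ (j + 1)) - pev γ (τ j)‖ ^ 2 / (τ (j + 1) - τ j) -
      V ((2 : ℝ)⁻¹ • (pev γ (τ (j + 1)) + pev γ (τ j))) * (τ (j + 1) - τ j))

open Classical in
/-- The discrete action `𝒜^{[h]}`: the midpoint-rule discrete action for piecewise affine
curves subordinate to the partition, `+∞` otherwise. -/
def dAction {n : ℕ} (m : ℝ) (V : Eu n → ℝ) (a b : ℝ) (τ : ℕ → ℝ) (l : ℕ)
    (γ : CPath a b n) : EReal :=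
  if PiecewiseAffine a b τ l γ then ((dActionSum m V τ l γ : ℝ) : EReal) else ⊤

/-- The discrete Euler–Lagrange equations for a piecewise affine curve subordinate to the
partition `a = τ₀ < … < τ_l = b`. -/
def DiscreteEL {n : ℕ} (m : ℝ) (V : Eu n → ℝ) {a b : ℝ} (τ : ℕ → ℝ) (l : ℕ)
    (γ : CPath a b n) : Prop :=
  ∀ j, 1 ≤ j → j < l →
    m • ((τ j - τ (j - 1))⁻¹ • (pev γ (τ j) - pev γ (τ (j - 1)))) -
      m • ((τ (j + 1) - τ j)⁻¹ • (pev γ (τ (j + 1)) - pev γ (τ j))) =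
    ((τ j - τ (j - 1)) / 2) • gradient V ((2 : ℝ)⁻¹ • (pev γ (τ (j - 1)) + pev γ (τ j))) +
      ((τ (j + 1) - τ j) / 2) • gradient V ((2 : ℝ)⁻¹ • (pev γ (τ j) + pev γ (τ (j + 1))))

end

noncomputable section

/-- Square-integrable velocities on `[a,b]`. -/
abbrev Vel (a b : ℝ) (n : ℕ) : Type := Lp (Eu n) 2 (volume.restrict (Set.Icc a b))

instance velMeasurableSpace (a b : ℝ) (n : ℕ) : MeasurableSpace (Vel a b n) :=
  borel _

instance velBorelSpace (a b : ℝ) (n : ℕ) : BorelSpace (Vel a b n) :=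
  ⟨rfl⟩

instance velPolishSpace (a b : ℝ) (n : ℕ) : PolishSpace (Vel a b n) := by
  have : Fact ((2 : ℝ≥0∞) ≠ ∞) := ⟨by simp⟩
  infer_instance

section Velocity

variable {a b : ℝ} {n : ℕ}

theorem Vel.integrable (g : Vel a b n) : Integrable g (volume.restrict (Set.Icc a b)) :=
  (Lp.memLp g).integrable one_le_two

theorem intervalIntegrable_of_integrableOn_Icc {E : Type*} [NormedAddCommGroup E] {g : ℝ → E}
    (hg : IntegrableOn g (Set.Icc a b)) {s t : ℝ} (hs : s ∈ Set.Icc a b) (ht : t ∈ Set.Icc a b) :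
    IntervalIntegrable g volume s t :=
  (hg.mono_set (Set.uIcc_subset_Icc hs ht)).intervalIntegrable

theorem Vel.intervalIntegrable (g : Vel a b n) {s t : ℝ} (hs : s ∈ Set.Icc a b)
    (ht : t ∈ Set.Icc a b) : IntervalIntegrable g volume s t :=
  intervalIntegrable_of_integrableOn_Icc g.integrable hs ht

theorem intervalIntegral_congr_ae_Icc {E : Type*} [NormedAddCommGroup E] [NormedSpace ℝ E]
    {f g : ℝ → E} (h : f =ᵐ[volume.restrict (Set.Icc a b)] g) {s t : ℝ} (hs : s ∈ Set.Icc a b)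
    (ht : t ∈ Set.Icc a b) : ∫ u in s..t, f u = ∫ u in s..t, g u := by
  refine intervalIntegral.integral_congr_ae_restrict ?_
  exact ae_restrict_of_ae_restrict_of_subset
    (Set.uIoc_subset_uIcc.trans (Set.uIcc_subset_Icc hs ht)) h

/-- A function on `[a,b]` all of whose interval integrals vanish is null. -/
theorem ae_eq_of_intervalIntegral_eq {E : Type*} [NormedAddCommGroup E] [NormedSpace ℝ E]
    [CompleteSpace E] (hab : a < b)
    {f g : ℝ → E} (hf : IntegrableOn f (Set.Icc a b)) (hg : IntegrableOn g (Set.Icc a b))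
    (h : ∀ t ∈ Set.Icc a b, ∫ u in a..t, f u = ∫ u in a..t, g u) :
    f =ᵐ[volume.restrict (Set.Icc a b)] g := by
  have ha : a ∈ Set.Icc a b := Set.left_mem_Icc.2 hab.le
  have hb : b ∈ Set.Icc a b := Set.right_mem_Icc.2 hab.le
  have h1 := (intervalIntegrable_of_integrableOn_Icc hf ha hb).ae_hasDerivAt_integral
  have h2 := (intervalIntegrable_of_integrableOn_Icc hg ha hb).ae_hasDerivAt_integral
  rw [← restrict_Ioo_eq_restrict_Icc, Filter.EventuallyEq, ae_restrict_iff' measurableSet_Ioo]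
  filter_upwards [h1, h2] with x hx1 hx2 hx
  have hx' : x ∈ Set.uIcc a b := by rw [Set.uIcc_of_le hab.le]; exact ⟨hx.1.le, hx.2.le⟩
  have e1 := hx1 hx' a Set.left_mem_uIcc
  have e2 := hx2 hx' a Set.left_mem_uIcc
  refine e1.unique (e2.congr_of_eventuallyEq ?_)
  filter_upwards [Icc_mem_nhds hx.1 hx.2] with t ht using h t ht

theorem continuousOn_primitive_Icc {g : ℝ → Eu n} (hg : IntegrableOn g (Set.Icc a b)) :
    ContinuousOn (fun t => ∫ u in a..t, g u) (Set.Icc a b) := by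
  refine (intervalIntegral.continuousOn_primitive hg).congr fun t ht => ?_
  simp only [intervalIntegral.integral_of_le ht.1]

theorem norm_primitive_le (g : Vel a b n) {t : ℝ} (ht : t ∈ Set.Icc a b) :
    ‖∫ u in a..t, g u‖ ≤
      ((volume.restrict (Set.Icc a b)) Set.univ ^ ((1 : ℝ) - 1 / 2)).toReal * ‖g‖ := by
  rw [intervalIntegral.integral_of_le ht.1]
  have h1 : ‖∫ u in Set.Ioc a t, g u‖ ≤ ∫ u in Set.Icc a b, ‖g u‖ :=
    (norm_integral_le_integral_norm _).trans
      (setIntegral_mono_set g.integrable.norm (ae_of_all _ fun _ => norm_nonneg _)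
        (Set.Ioc_subset_Icc_self.trans (Set.Icc_subset_Icc_right ht.2)).eventuallyLE)
  refine h1.trans ?_
  have h2 := eLpNorm_le_eLpNorm_mul_rpow_measure_univ (μ := volume.restrict (Set.Icc a b))
    (one_le_two : (1 : ℝ≥0∞) ≤ 2) (Lp.aestronglyMeasurable g)
  rw [integral_norm_eq_lintegral_enorm (Lp.aestronglyMeasurable g), ← eLpNorm_one_eq_lintegral_enorm,
    Lp.norm_def, mul_comm, ← ENNReal.toReal_mul]
  refine ENNReal.toReal_mono ?_ (by simpa using h2)
  exact ENNReal.mul_ne_top (Lp.eLpNorm_ne_top g)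
    (ENNReal.rpow_ne_top_of_nonneg (by norm_num) (measure_ne_top _ _))

/-- The primitive vanishing at `a`, as a continuous linear map from velocities to paths. -/
def primitiveL (hab : a < b) (n : ℕ) : Vel a b n →L[ℝ] CPath a b n :=
  LinearMap.mkContinuous
    { toFun := fun g => ⟨fun t => ∫ u in a..(t : ℝ), g u,
        continuousOn_iff_continuous_domRestrict.1 (continuousOn_primitive_Icc g.integrable)⟩
      map_add' := fun f g => by
        ext1 t
        have ha : a ∈ Set.Icc a b := Set.left_mem_Icc.2 hab.le
        have := intervalIntegral_congr_ae_Icc (Lp.coeFn_add f g) ha t.2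
        refine this.trans ?_
        exact intervalIntegral.integral_add (f.intervalIntegrable ha t.2)
          (g.intervalIntegrable ha t.2)
      map_smul' := fun c g => by
        ext1 t
        have ha : a ∈ Set.Icc a b := Set.left_mem_Icc.2 hab.le
        have := intervalIntegral_congr_ae_Icc (Lp.coeFn_smul c g) ha t.2
        refine this.trans ?_
        exact intervalIntegral.integral_smul c _ }
    ((volume.restrict (Set.Icc a b)) Set.univ ^ ((1 : ℝ) - 1 / 2)).toReal
    fun g => (ContinuousMap.norm_le _ (by positivity)).2 fun t => norm_primitive_le g t.2

theorem primitiveL_apply (hab : a < b) (g : Vel a b n) (t : Set.Icc a b) :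
    primitiveL hab n g t = ∫ u in a..(t : ℝ), g u := rfl

/-- The path with initial point `p.1` and velocity `p.2`. -/
def pathOf (hab : a < b) (p : Eu n × Vel a b n) : CPath a b n :=
  ContinuousMap.const _ p.1 + primitiveL hab n p.2

theorem pathOf_apply (hab : a < b) (p : Eu n × Vel a b n) (t : Set.Icc a b) :
    pathOf hab p t = p.1 + ∫ u in a..(t : ℝ), p.2 u := rfl

theorem continuous_pathOf (hab : a < b) : Continuous (pathOf (n := n) hab) := by
  unfold pathOf
  exact (ContinuousMap.continuous_const'.comp continuous_fst).add
    ((primitiveL hab n).continuous.comp continuous_snd)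

theorem pathOf_add_velocity (hab : a < b) (x : Eu n) (g k : Vel a b n) :
    pathOf hab (x, g + k) = pathOf hab (x, g) + primitiveL hab n k := by
  simp [pathOf, add_assoc]

theorem injective_pathOf (hab : a < b) : Function.Injective (pathOf (n := n) hab) := by
  rintro ⟨x, g⟩ ⟨y, k⟩ h
  have ha : a ∈ Set.Icc a b := Set.left_mem_Icc.2 hab.le
  have hxy : x = y := by simpa [pathOf_apply] using DFunLike.congr_fun h ⟨a, ha⟩
  subst hxy
  refine Prod.ext rfl (Lp.ext (ae_eq_of_intervalIntegral_eq hab g.integrable k.integrable ?_))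
  intro t ht
  simpa [pathOf_apply] using DFunLike.congr_fun h ⟨t, ht⟩

theorem measurableEmbedding_pathOf (hab : a < b) :
    MeasurableEmbedding (pathOf (n := n) hab) :=
  (continuous_pathOf hab).measurableEmbedding (injective_pathOf hab)

theorem isACC_pathOf (hab : a < b) (p : Eu n × Vel a b n) : IsACC (pathOf hab p) := by
  refine ⟨p.2, p.2.integrable, fun s t => ?_⟩
  have ha : a ∈ Set.Icc a b := Set.left_mem_Icc.2 hab.le
  rw [pathOf_apply, pathOf_apply, add_assoc, intervalIntegral.integral_add_adjacent_intervals
    (p.2.intervalIntegrable ha s.2) (p.2.intervalIntegrable s.2 t.2)]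

theorem ae_eq_velocity (hab : a < b) (p : Eu n × Vel a b n) {g : ℝ → Eu n}
    (hg : IntegrableOn g (Set.Icc a b))
    (h : ∀ s t : Set.Icc a b, pathOf hab p t = pathOf hab p s + ∫ u in (s : ℝ)..(t : ℝ), g u) :
    g =ᵐ[volume.restrict (Set.Icc a b)] p.2 := by
  have ha : a ∈ Set.Icc a b := Set.left_mem_Icc.2 hab.le
  refine ae_eq_of_intervalIntegral_eq hab hg p.2.integrable fun t ht => ?_
  simpa [pathOf_apply] using (h ⟨a, ha⟩ ⟨t, ht⟩).symm

end Velocity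

section ReducedAction

variable {a b : ℝ} {n : ℕ}

theorem continuousOn_pev (γ : CPath a b n) : ContinuousOn (pev γ) (Set.Icc a b) := by
  rw [continuousOn_iff_continuous_domRestrict]
  refine γ.continuous.congr fun t => ?_
  simp [pev]

theorem continuous_pev (t : ℝ) : Continuous fun γ : CPath a b n => pev γ t := by
  by_cases ht : t ∈ Set.Icc a b
  · simpa [pev, ht] using continuous_eval_const (F := CPath a b n) ⟨t, ht⟩
  · simpa [pev, ht] using continuous_const

theorem integrable_potential {V : Eu n → ℝ} (hV : Continuous V) (γ : CPath a b n) :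
    IntegrableOn (fun t => V (pev γ t)) (Set.Icc a b) :=
  (hV.comp_continuousOn (continuousOn_pev γ)).integrableOn_compact isCompact_Icc

theorem continuous_integral_potential {V : Eu n → ℝ} (hV : Continuous V) {C : ℝ}
    (hC : ∀ x, |V x| ≤ C) :
    Continuous fun γ : CPath a b n => ∫ t in Set.Icc a b, V (pev γ t) := by
  refine continuous_of_dominated (bound := fun _ => C)
    (fun γ => (integrable_potential hV γ).aestronglyMeasurable)
    (fun γ => ae_of_all _ fun t => hC _) (integrable_const C)
    (ae_of_all _ fun t => hV.comp (continuous_pev t))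

/-- The action of `pathOf hab p` in terms of its initial point and velocity. -/
def reducedAction (m : ℝ) (V : Eu n → ℝ) (hab : a < b) (p : Eu n × Vel a b n) : ℝ :=
  m / 2 * ‖p.2‖ ^ 2 - ∫ t in Set.Icc a b, V (pev (pathOf hab p) t)

theorem continuous_reducedAction (m : ℝ) {V : Eu n → ℝ} (hab : a < b) (hV : Continuous V) {C : ℝ}
    (hC : ∀ x, |V x| ≤ C) : Continuous (reducedAction m V hab) := by
  unfold reducedAction
  exact (continuous_const.mul (continuous_snd.norm.pow 2)).sub
    ((continuous_integral_potential hV hC).comp (continuous_pathOf hab))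

theorem le_reducedAction {m : ℝ} (hm : 0 < m) {V : Eu n → ℝ} (hab : a < b) (hV : Continuous V)
    {C : ℝ} (hC : ∀ x, |V x| ≤ C) (p : Eu n × Vel a b n) :
    -(C * (b - a)) ≤ reducedAction m V hab p := by
  have h1 : ∫ t in Set.Icc a b, V (pev (pathOf hab p) t) ≤ ∫ _t in Set.Icc a b, C :=
    integral_mono (integrable_potential hV _) (integrable_const C)
      fun t => (le_abs_self _).trans (hC _)
  have h2 : ∫ _t in Set.Icc a b, C = C * (b - a) := by
    simp [hab.le, mul_comm]
  have h3 : 0 ≤ m / 2 * ‖p.2‖ ^ 2 := by positivity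
  unfold reducedAction
  linarith

theorem Vel.integrable_sq_norm (g : Vel a b n) :
    IntegrableOn (fun t => ‖g t‖ ^ 2) (Set.Icc a b) :=
  (memLp_two_iff_integrable_sq_norm (Lp.aestronglyMeasurable g)).1 (Lp.memLp g)

theorem Vel.integral_sq_norm (g : Vel a b n) : ∫ t in Set.Icc a b, ‖g t‖ ^ 2 = ‖g‖ ^ 2 := by
  rw [← real_inner_self_eq_norm_sq, L2.inner_def]
  simp only [real_inner_self_eq_norm_sq]

theorem action_pathOf {m : ℝ} {V : Eu n → ℝ} (hab : a < b) (hV : Continuous V)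
    {L : Eu n → Eu n → ℝ} (hL : ∀ x v : Eu n, L x v = m / 2 * ‖v‖ ^ 2 - V x)
    (p : Eu n × Vel a b n) :
    action L a b (pathOf hab p) = (reducedAction m V hab p : EReal) := by
  have h := isACC_pathOf hab p
  have hg := ae_eq_velocity hab p h.choose_spec.1 h.choose_spec.2
  have hae : (fun t => L (pev (pathOf hab p) t) (h.choose t))
      =ᵐ[volume.restrict (Set.Icc a b)]
      fun t => m / 2 * ‖p.2 t‖ ^ 2 - V (pev (pathOf hab p) t) := by
    filter_upwards [hg] with t ht
    rw [hL, ht]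
  have hi1 := p.2.integrable_sq_norm.const_mul (m / 2)
  have hi2 := integrable_potential hV (pathOf hab p)
  have hint : IntegrableOn (fun t => L (pev (pathOf hab p) t) (h.choose t)) (Set.Icc a b) :=
    (hi1.sub hi2).congr hae.symm
  rw [action, dif_pos h, if_pos hint, integral_congr_ae hae, integral_sub hi1 hi2,
    integral_const_mul, p.2.integral_sq_norm, reducedAction]

theorem mem_range_pathOf_of_action_ne_top {m : ℝ} (hm : 0 < m) {V : Eu n → ℝ} (hab : a < b)
    (hV : Continuous V) {L : Eu n → Eu n → ℝ}
    (hL : ∀ x v : Eu n, L x v = m / 2 * ‖v‖ ^ 2 - V x) {γ : CPath a b n}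
    (hγ : action L a b γ ≠ ⊤) : γ ∈ Set.range (pathOf (n := n) hab) := by
  unfold action at hγ
  split_ifs at hγ with h hint
  · obtain ⟨hg, hgγ⟩ := h.choose_spec
    set g := h.choose
    have hsq : Integrable (fun t => ‖g t‖ ^ 2) (volume.restrict (Set.Icc a b)) := by
      refine ((hint.add (integrable_potential hV γ)).const_mul (2 / m)).congr
        (ae_of_all _ fun t => ?_)
      simp only [Pi.add_apply, hL]
      field_simp
      ring
    have hmem : MemLp g 2 (volume.restrict (Set.Icc a b)) :=
      (memLp_two_iff_integrable_sq_norm hg.aestronglyMeasurable).2 hsq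
    have ha : a ∈ Set.Icc a b := Set.left_mem_Icc.2 hab.le
    refine ⟨(γ ⟨a, ha⟩, hmem.toLp g), ?_⟩
    ext1 t
    rw [pathOf_apply, intervalIntegral_congr_ae_Icc hmem.coeFn_toLp ha t.2]
    exact (hgγ ⟨a, ha⟩ t).symm
  · exact absurd rfl hγ
  · exact absurd rfl hγ

end ReducedAction

section Minimality

variable {X Y : Type*} [MeasurableSpace X] [MeasurableSpace Y]

theorem epos_coe (r : ℝ) : epos (r : EReal) = ENNReal.ofReal r := by
  simp [epos]

theorem epos_neg_coe (r : ℝ) : epos (-(r : EReal)) = ENNReal.ofReal (-r) := by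
  rw [← EReal.coe_neg, epos_coe]

/-- If `F` is real-valued and integrable along a measurable embedding, then `mint` is the
Bochner integral. No measurability of `F` off the range is needed. -/
theorem mint_map {J : X → Y} (hJ : MeasurableEmbedding J) {F : Y → EReal} {A : X → ℝ}
    (hF : ∀ x, F (J x) = (A x : EReal)) {ρ : Measure X} (hA : Integrable A ρ) :
    mint F (ρ.map J) = ((∫ x, A x ∂ρ : ℝ) : EReal) := by
  have h1 : ∫⁻ x, ENNReal.ofReal (A x) ∂ρ ≠ ⊤ := hA.lintegral_lt_top.ne
  have h2 : ∫⁻ x, ENNReal.ofReal (-A x) ∂ρ ≠ ⊤ := hA.neg.lintegral_lt_top.ne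
  rw [integral_eq_lintegral_pos_part_sub_lintegral_neg_part hA, EReal.coe_sub, mint,
    hJ.lintegral_map, hJ.lintegral_map]
  simp only [hF, epos_coe, epos_neg_coe]
  rw [EReal.coe_ennreal_toReal h1, EReal.coe_ennreal_toReal h2]

theorem lintegral_epos_ne_top_of_mint_lt_top {F : Y → EReal} {π : Measure Y} [IsFiniteMeasure π]
    {C : ℝ} (hF : ∀ y, ((-C : ℝ) : EReal) ≤ F y) (h : mint F π < ⊤) :
    ∫⁻ y, epos (F y) ∂π ≠ ⊤ := by
  have hQ : ∫⁻ y, epos (-(F y)) ∂π ≠ ⊤ := by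
    refine ne_top_of_le_ne_top
      (ENNReal.mul_ne_top (ENNReal.ofReal_ne_top (r := C)) (measure_ne_top π Set.univ)) ?_
    rw [← lintegral_const]
    refine lintegral_mono fun y => ?_
    have hy := hF y
    induction hFy : F y with
    | bot => simp [hFy] at hy
    | top => simp [epos]
    | coe r =>
      rw [hFy, EReal.coe_le_coe_iff] at hy
      rw [epos_neg_coe]
      exact ENNReal.ofReal_le_ofReal (by linarith)
  intro hP
  rw [mint, hP, ← EReal.coe_ennreal_toReal hQ, EReal.coe_ennreal_top, EReal.top_sub_coe] at h
  exact lt_irrefl _ h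

theorem measure_eq_zero_of_lintegral_epos_ne_top {F : Y → EReal} {π : Measure Y} {s : Set Y}
    (hs : MeasurableSet s) (hF : ∀ y ∈ s, F y = ⊤) (h : ∫⁻ y, epos (F y) ∂π ≠ ⊤) : π s = 0 := by
  by_contra h0
  refine h (top_le_iff.1 ?_)
  calc (⊤ : ℝ≥0∞) = ∫⁻ _ in s, ⊤ ∂π := by simp [h0]
    _ ≤ ∫⁻ y in s, epos (F y) ∂π := setLIntegral_mono' hs fun y hy => by simp [epos, hF y hy]
    _ ≤ ∫⁻ y, epos (F y) ∂π := setLIntegral_le_lintegral _ _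

theorem integrable_of_lintegral_ofReal_ne_top {A : X → ℝ} (hA : Measurable A) {C : ℝ}
    (hC : ∀ x, -C ≤ A x) {ρ : Measure X} [IsFiniteMeasure ρ]
    (h : ∫⁻ x, ENNReal.ofReal (A x) ∂ρ ≠ ⊤) : Integrable A ρ := by
  refine ⟨hA.aestronglyMeasurable, ?_⟩
  have hle : ∫⁻ x, ‖A x‖ₑ ∂ρ ≤ ∫⁻ x, (ENNReal.ofReal (A x) + ENNReal.ofReal C) ∂ρ := by
    refine lintegral_mono fun x => ?_
    rw [Real.enorm_eq_ofReal_abs]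
    rcases le_total 0 (A x) with h0 | h0
    · rw [abs_of_nonneg h0]
      exact le_self_add
    · rw [abs_of_nonpos h0]
      exact le_add_left (ENNReal.ofReal_le_ofReal (by linarith [hC x]))
  refine hle.trans_lt ?_
  rw [lintegral_add_right _ measurable_const, lintegral_const]
  exact ENNReal.add_lt_top.2 ⟨h.lt_top,
    ENNReal.mul_lt_top ENNReal.ofReal_lt_top (measure_lt_top _ _)⟩

/-- If `∫ A` cannot be decreased by applying `S` on part of the space, then `A ≤ A ∘ S` almost
everywhere. -/
theorem ae_le_comp_of_integral_le {A : X → ℝ} (hA : Measurable A) {C : ℝ} (hC : ∀ x, -C ≤ A x)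
    {ρ : Measure X} [IsFiniteMeasure ρ] (hint : Integrable A ρ) {S : X → X} (hS : Measurable S)
    (hmin : ∀ T : X → X, Measurable T → (∀ x, T x = x ∨ T x = S x) →
      Integrable (fun x => A (T x)) ρ → ∫ x, A x ∂ρ ≤ ∫ x, A (T x) ∂ρ) :
    ∀ᵐ x ∂ρ, A x ≤ A (S x) := by
  classical
  set B : Set X := {x | A (S x) < A x} with hB
  have hBm : MeasurableSet B := measurableSet_lt (hA.comp hS) hA
  set T : X → X := B.piecewise S id
  have hT : Measurable T := hS.piecewise hBm measurable_id
  have hTB : ∀ x ∈ B, T x = S x := fun x hx => Set.piecewise_eq_of_mem _ _ _ hx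
  have hTle : ∀ x, A (T x) ≤ A x := fun x => by
    by_cases hx : x ∈ B
    · rw [hTB x hx]
      exact le_of_lt hx
    · simp [T, hx]
  have hTint : Integrable (fun x => A (T x)) ρ := by
    refine (hint.abs.add (integrable_const |C|)).mono' (hA.comp hT).aestronglyMeasurable
      (ae_of_all _ fun x => ?_)
    have h1 := hTle x
    have h2 := hC (T x)
    simp only [Pi.add_apply, Real.norm_eq_abs]
    refine abs_le.2 ⟨?_, ?_⟩
    · linarith [abs_nonneg (A x), le_abs_self C]
    · linarith [abs_nonneg C, le_abs_self (A x)]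
  have hcase : ∀ x, T x = x ∨ T x = S x := fun x => by
    by_cases hx : x ∈ B
    · exact Or.inr (hTB x hx)
    · left; simp [T, hx]
  have hle := hmin T hT hcase hTint
  have hnn : 0 ≤ᵐ[ρ] fun x => A x - A (T x) := ae_of_all _ fun x => sub_nonneg.2 (hTle x)
  have hzero : ∫ x, (A x - A (T x)) ∂ρ = 0 :=
    le_antisymm (by rw [integral_sub hint hTint]; linarith) (integral_nonneg_of_ae hnn)
  filter_upwards [(integral_eq_zero_iff_of_nonneg_ae hnn (hint.sub hTint)).1 hzero] with x hx
  by_contra hlt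
  have hxB : x ∈ B := not_le.1 hlt
  simp only [hTB x hxB, Pi.zero_apply] at hx
  linarith [not_le.1 hlt]

end Minimality

/-- An optimal measure is carried by paths with square-integrable velocity, almost all of which
minimize the action among paths with the same endpoints. -/
theorem exists_map_pathOf_ae_minimal {n : ℕ} {a b : ℝ} (hab : a < b)
    {m : ℝ} (hm : 0 < m) {V : Eu n → ℝ} (hV : Continuous V) {C : ℝ} (hC : ∀ x, |V x| ≤ C)
    {L : Eu n → Eu n → ℝ} (hL : ∀ x v : Eu n, L x v = m / 2 * ‖v‖ ^ 2 - V x)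
    {μa μb : Measure (Eu n)} {π : Measure (CPath a b n)} [IsProbabilityMeasure π]
    (hmin : ∀ π' : Measure (CPath a b n), IsProbabilityMeasure π' →
      aFun (action L a b) μa μb π ≤ aFun (action L a b) μa μb π')
    (hfin : aFun (action L a b) μa μb π < ⊤) :
    ∃ ρ : Measure (Eu n × Vel a b n), π = ρ.map (pathOf hab) ∧
      ∀ᵐ p ∂ρ, ∀ k : Vel a b n, primitiveL hab n k ⟨b, Set.right_mem_Icc.2 hab.le⟩ = 0 →
        reducedAction m V hab p ≤ reducedAction m V hab (p.1, p.2 + k) := by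
  have hJ := measurableEmbedding_pathOf (n := n) hab
  have hFJ := action_pathOf hab hV hL
  have hAcont := continuous_reducedAction m hab hV hC
  have hAlow := le_reducedAction hm hab hV hC
  have hmarg : Measure.map (fun γ => pev γ a) π = μa ∧ Measure.map (fun γ => pev γ b) π = μb := by
    by_contra h
    rw [aFun, if_neg h] at hfin
    exact lt_irrefl _ hfin
  have hFlow : ∀ γ : CPath a b n, ((-(C * (b - a)) : ℝ) : EReal) ≤ action L a b γ := fun γ => by
    by_cases h : action L a b γ = ⊤
    · rw [h]; exact le_top
    · obtain ⟨p, rfl⟩ := mem_range_pathOf_of_action_ne_top hm hab hV hL h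
      rw [hFJ]
      exact EReal.coe_le_coe_iff.2 (hAlow p)
  have hfin' := hfin
  rw [aFun, if_pos hmarg] at hfin'
  have hpos := lintegral_epos_ne_top_of_mint_lt_top hFlow hfin'
  have hnull : π (Set.range (pathOf (n := n) hab))ᶜ = 0 :=
    measure_eq_zero_of_lintegral_epos_ne_top hJ.measurableSet_range.compl
      (fun γ hγ => by
        by_contra h
        exact hγ (mem_range_pathOf_of_action_ne_top hm hab hV hL h)) hpos
  set ρ := π.comap (pathOf (n := n) hab)
  have hρ : ρ.map (pathOf hab) = π := by
    rw [hJ.map_comap]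
    exact Measure.restrict_eq_self_of_ae_mem (measure_eq_zero_iff_ae_notMem.1 hnull |>.mono
      fun γ hγ => not_not.1 hγ)
  have hρprob : IsProbabilityMeasure ρ := by
    have : IsProbabilityMeasure (ρ.map (pathOf hab)) := by rw [hρ]; infer_instance
    exact Measure.isProbabilityMeasure_of_map (pathOf hab)
  have hint : Integrable (reducedAction m V hab) ρ := by
    refine integrable_of_lintegral_ofReal_ne_top hAcont.measurable hAlow ?_
    rw [← hρ, hJ.lintegral_map] at hpos
    simpa only [hFJ, epos_coe] using hpos
  refine ⟨ρ, hρ.symm, ?_⟩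
  set M : Set (Vel a b n) :=
    {k | primitiveL hab n k ⟨b, Set.right_mem_Icc.2 hab.le⟩ = 0} with hM
  have hMne : Nonempty M := ⟨⟨0, by simp [hM]⟩⟩
  have key : ∀ k ∈ M, ∀ᵐ p ∂ρ,
      reducedAction m V hab p ≤ reducedAction m V hab (p.1, p.2 + k) := by
    intro k hk
    have hS : Continuous fun p : Eu n × Vel a b n => (p.1, p.2 + k) := by fun_prop
    refine ae_le_comp_of_integral_le hAcont.measurable hAlow hint hS.measurable ?_
    intro T hT hTcase hTint
    have hTprob : IsProbabilityMeasure (ρ.map T) := Measure.isProbabilityMeasure_map hT.aemeasurable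
    have hπ' : IsProbabilityMeasure ((ρ.map T).map (pathOf hab)) :=
      Measure.isProbabilityMeasure_map hJ.measurable.aemeasurable
    have hend : ∀ t ∈ ({a, b} : Set ℝ), ∀ p, pev (pathOf hab (T p)) t = pev (pathOf hab p) t := by
      intro t ht p
      rcases hTcase p with h | h
      · rw [h]
      · rw [h, pathOf_add_velocity]
        rcases ht with rfl | rfl
        · simp [pev, hab.le, primitiveL_apply]
        · have hk' : primitiveL hab n k ⟨t, Set.right_mem_Icc.2 hab.le⟩ = 0 := hk
          simp [pev, hab.le, hk']
    have hmap : ∀ t ∈ ({a, b} : Set ℝ),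
        Measure.map (fun γ => pev γ t) ((ρ.map T).map (pathOf hab))
          = Measure.map (fun γ => pev γ t) π := by
      intro t ht
      have hp : Measurable fun γ : CPath a b n => pev γ t := (continuous_pev t).measurable
      rw [← hρ, Measure.map_map hp hJ.measurable, Measure.map_map hp hJ.measurable,
        Measure.map_map (hp.comp hJ.measurable) hT]
      congr 1
      funext p
      exact hend t ht p
    have hle := hmin _ hπ'
    rw [aFun, aFun, if_pos hmarg, if_pos ⟨by rw [hmap a (by simp), hmarg.1],
      by rw [hmap b (by simp), hmarg.2]⟩, ← hρ, mint_map hJ hFJ hint,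
      mint_map hJ hFJ ((integrable_map_measure hAcont.aestronglyMeasurable hT.aemeasurable).2 hTint),
      EReal.coe_le_coe_iff, integral_map hT.aemeasurable hAcont.aestronglyMeasurable] at hle
    exact hle
  have hall : ∀ᵐ p ∂ρ, ∀ i : ℕ, reducedAction m V hab p ≤
      reducedAction m V hab (p.1, p.2 + (TopologicalSpace.denseSeq M i : Vel a b n)) :=
    ae_all_iff.2 fun i => key _ (TopologicalSpace.denseSeq M i).2
  filter_upwards [hall] with p hp k hk
  refine (TopologicalSpace.denseRange_denseSeq M).induction_on
    (p := fun k : M => reducedAction m V hab p ≤ reducedAction m V hab (p.1, p.2 + (k : Vel a b n)))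
    ⟨k, hk⟩ ?_ hp
  exact isClosed_le continuous_const (hAcont.comp (by fun_prop))

section FirstVariation

variable {a b : ℝ} {n : ℕ}

theorem gradient_eq_toDual_symm (V : Eu n → ℝ) :
    gradient V = fun x => (InnerProductSpace.toDual ℝ (Eu n)).symm (fderiv ℝ V x) := rfl

theorem continuous_gradient {V : Eu n → ℝ} (hV : ContDiff ℝ 2 V) : Continuous (gradient V) := by
  rw [gradient_eq_toDual_symm]
  exact (LinearIsometryEquiv.continuous _).comp (hV.continuous_fderiv (by norm_num))

theorem exists_lipschitzOnWith_gradient {V : Eu n → ℝ} (hV : ContDiff ℝ 2 V) (R : ℝ) :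
    ∃ K, LipschitzOnWith K (gradient V) (Metric.closedBall 0 R) := by
  have h1 : ContDiff ℝ 1 (fderiv ℝ V) := hV.fderiv_right (by norm_num)
  obtain ⟨K, hK⟩ := h1.contDiffOn.exists_lipschitzOnWith (s := Metric.closedBall (0 : Eu n) R)
    one_ne_zero (convex_closedBall _ _) (isCompact_closedBall _ _)
  refine ⟨1 * K, ?_⟩
  rw [gradient_eq_toDual_symm]
  exact (InnerProductSpace.toDual ℝ (Eu n)).symm.lipschitz.comp_lipschitzOnWith hK

theorem norm_pev_le (γ : CPath a b n) (t : ℝ) : ‖pev γ t‖ ≤ ‖γ‖ := by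
  unfold pev
  split_ifs with ht
  · exact γ.norm_coe_le_norm _
  · simp

theorem pev_add_smul (γ h : CPath a b n) (s t : ℝ) :
    pev (γ + s • h) t = pev γ t + s • pev h t := by
  unfold pev
  split_ifs <;> simp

theorem hasDerivAt_integral_potential {V : Eu n → ℝ} (hV : ContDiff ℝ 2 V) (γ h : CPath a b n) :
    HasDerivAt (fun s : ℝ => ∫ t in Set.Icc a b, V (pev (γ + s • h) t))
      (∫ t in Set.Icc a b, inner ℝ (gradient V (pev γ t)) (pev h t)) 0 := by
  obtain ⟨B, hB⟩ := (isCompact_closedBall (0 : Eu n) (‖γ‖ + ‖h‖)).exists_bound_of_continuousOn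
    (continuous_gradient hV).continuousOn
  have hcont : ∀ γ h : CPath a b n, ContinuousOn
      (fun t => inner ℝ (gradient V (pev γ t)) (pev h t)) (Set.Icc a b) := fun γ h =>
    ((continuous_gradient hV).comp_continuousOn (continuousOn_pev γ)).inner (continuousOn_pev h)
  have key := hasDerivAt_integral_of_dominated_loc_of_deriv_le
    (μ := volume.restrict (Set.Icc a b)) (x₀ := (0 : ℝ))
    (F := fun s t => V (pev (γ + s • h) t))
    (F' := fun s t => inner ℝ (gradient V (pev (γ + s • h) t)) (pev h t))
    (s := Metric.ball 0 1) (bound := fun _ => B * ‖h‖)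
    (Metric.ball_mem_nhds 0 one_pos)
    (Filter.Eventually.of_forall fun s =>
      (integrable_potential hV.continuous _).aestronglyMeasurable)
    (integrable_potential hV.continuous _)
    ((hcont _ _).aestronglyMeasurable measurableSet_Icc) ?_ (integrable_const _) ?_
  · simpa only [pev_add_smul, zero_smul, add_zero] using key.2
  · refine ae_of_all _ fun t s hs => (norm_inner_le_norm _ _).trans ?_
    have hs' : |s| ≤ 1 := by simpa using (mem_ball_zero_iff.1 hs).le
    have hmem : pev (γ + s • h) t ∈ Metric.closedBall (0 : Eu n) (‖γ‖ + ‖h‖) := by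
      rw [mem_closedBall_zero_iff]
      refine (norm_pev_le _ _).trans ((norm_add_le _ _).trans ?_)
      rw [norm_smul, Real.norm_eq_abs]
      nlinarith [norm_nonneg h]
    exact mul_le_mul (hB _ hmem) (norm_pev_le _ _) (norm_nonneg _)
      ((norm_nonneg _).trans (hB _ hmem))
  · refine ae_of_all _ fun t s _ => ?_
    simp only [pev_add_smul]
    have h1 := ((hV.differentiable (by norm_num)) (pev γ t + s • pev h t)).hasGradientAt.hasFDerivAt
    have h2 : HasDerivAt (fun s : ℝ => pev γ t + s • pev h t) (pev h t) s := by
      simpa using ((hasDerivAt_id s).smul_const (pev h t)).const_add (pev γ t)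
    exact h1.comp_hasDerivAt s h2

theorem hasDerivAt_reducedAction (m : ℝ) {V : Eu n → ℝ} (hab : a < b) (hV : ContDiff ℝ 2 V)
    (p : Eu n × Vel a b n) (k : Vel a b n) :
    HasDerivAt (fun s : ℝ => reducedAction m V hab (p.1, p.2 + s • k))
      (m * inner ℝ p.2 k - ∫ t in Set.Icc a b,
        inner ℝ (gradient V (pev (pathOf hab p) t)) (pev (primitiveL hab n k) t)) 0 := by
  have h1 := hasDerivAt_integral_potential hV (pathOf hab p) (primitiveL hab n k)
  have h2 : HasDerivAt (fun s : ℝ => p.2 + s • k) k 0 := by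
    simpa using ((hasDerivAt_id (0 : ℝ)).smul_const k).const_add p.2
  have h3 := (h2.norm_sq.const_mul (m / 2)).sub h1
  refine (h3.congr_deriv ?_).congr_of_eventuallyEq (Filter.Eventually.of_forall fun s => ?_)
  · simp only [zero_smul, add_zero]
    ring
  · simp only [reducedAction, Pi.sub_apply, pathOf_add_velocity, map_smul]

theorem integral_inner_primitive {N k : ℝ → Eu n} (hab : a < b) (hN : Continuous N)
    (hk : IntegrableOn k (Set.Icc a b)) :
    ∫ t in Set.Icc a b, inner ℝ (N t) (∫ u in a..t, k u)
      = ∫ s in Set.Icc a b, inner ℝ (∫ u in s..b, N u) (k s) := by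
  have ha : a ∈ Set.Icc a b := Set.left_mem_Icc.2 hab.le
  have hb : b ∈ Set.Icc a b := Set.right_mem_Icc.2 hab.le
  have hNi : IntegrableOn N (Set.Icc a b) := hN.continuousOn.integrableOn_compact isCompact_Icc
  set μ := volume.restrict (Set.Icc a b) with hμ
  set f : ℝ → ℝ → ℝ := fun t s =>
    Set.indicator {q : ℝ × ℝ | q.2 ≤ q.1} (fun q => inner ℝ (N q.1) (k q.2)) (t, s)
  have hf : Integrable (Function.uncurry f) (μ.prod μ) := by
    have hmeas : MeasurableSet {q : ℝ × ℝ | q.2 ≤ q.1} :=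
      measurableSet_le measurable_snd measurable_fst
    refine Integrable.indicator ?_ hmeas
    refine (hNi.norm.mul_prod hk.norm).mono' (hNi.1.comp_fst.inner hk.1.comp_snd)
      (ae_of_all _ fun q => norm_inner_le_norm _ _)
  have h1 : ∀ t ∈ Set.Icc a b, inner ℝ (N t) (∫ u in a..t, k u) = ∫ s, f t s ∂μ := by
    intro t ht
    have hfe : f t = Set.indicator (Set.Iic t) fun s => inner ℝ (N t) (k s) := by
      funext s; simp [f, Set.indicator_apply]
    have hset : Set.Iic t ∩ Set.Icc a b = Set.Icc a t := by
      ext s; simp only [Set.mem_inter_iff, Set.mem_Iic, Set.mem_Icc]; grind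
    rw [hfe, integral_indicator measurableSet_Iic, hμ, Measure.restrict_restrict measurableSet_Iic,
      hset, integral_Icc_eq_integral_Ioc, ← intervalIntegral.integral_of_le ht.1]
    exact ((innerSL ℝ (N t)).intervalIntegral_comp_comm
      (intervalIntegrable_of_integrableOn_Icc hk ha ht)).symm
  have h2 : ∀ s ∈ Set.Icc a b, inner ℝ (∫ u in s..b, N u) (k s) = ∫ t, f t s ∂μ := by
    intro s hs
    have hfe : (fun t => f t s) = Set.indicator (Set.Ici s) fun t => inner ℝ (N t) (k s) := by
      funext t; simp [f, Set.indicator_apply]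
    have hset : Set.Ici s ∩ Set.Icc a b = Set.Icc s b := by
      ext t; simp only [Set.mem_inter_iff, Set.mem_Ici, Set.mem_Icc]; grind
    rw [hfe, integral_indicator measurableSet_Ici, hμ, Measure.restrict_restrict measurableSet_Ici,
      hset, integral_Icc_eq_integral_Ioc, ← intervalIntegral.integral_of_le hs.2]
    simp_rw [real_inner_comm (k s)]
    exact ((innerSL ℝ (k s)).intervalIntegral_comp_comm
      (hN.intervalIntegrable s b)).symm
  rw [setIntegral_congr_fun measurableSet_Icc h1, setIntegral_congr_fun measurableSet_Icc h2]
  exact integral_integral_swap hf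

theorem pev_eq_IccExtend (hab : a < b) (γ : CPath a b n) {t : ℝ} (ht : t ∈ Set.Icc a b) :
    pev γ t = Set.IccExtend hab.le γ t := by
  rw [pev, dif_pos ht, Set.IccExtend_of_mem hab.le γ ht]

/-- A velocity orthogonal to all velocities with zero integral is constant. -/
theorem ae_eq_const_of_inner_eq_zero (hab : a < b) (w : Vel a b n)
    (h : ∀ k : Vel a b n, primitiveL hab n k ⟨b, Set.right_mem_Icc.2 hab.le⟩ = 0 →
      inner ℝ w k = 0) :
    ∃ c : Eu n, w =ᵐ[volume.restrict (Set.Icc a b)] fun _ => c := by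
  have ha : a ∈ Set.Icc a b := Set.left_mem_Icc.2 hab.le
  have hb : b ∈ Set.Icc a b := Set.right_mem_Icc.2 hab.le
  set c : Eu n := (b - a)⁻¹ • ∫ u in a..b, w u
  have hcm : MemLp (fun _ : ℝ => c) 2 (volume.restrict (Set.Icc a b)) := memLp_const c
  set C : Vel a b n := hcm.toLp _
  have hC : C =ᵐ[volume.restrict (Set.Icc a b)] fun _ => c := hcm.coeFn_toLp
  have hk : primitiveL hab n (w - C) ⟨b, hb⟩ = 0 := by
    rw [map_sub, ContinuousMap.sub_apply, primitiveL_apply, primitiveL_apply,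
      intervalIntegral_congr_ae_Icc hC ha hb, intervalIntegral.integral_const, smul_smul,
      mul_inv_cancel₀ (sub_pos.2 hab).ne', one_smul, sub_self]
  have hCk : inner ℝ C (w - C) = 0 := by
    rw [L2.inner_def]
    have : (fun t => inner ℝ (C t) ((w - C : Vel a b n) t)) =ᵐ[volume.restrict (Set.Icc a b)]
        fun t => inner ℝ c ((w - C : Vel a b n) t) := by
      filter_upwards [hC] with t ht
      rw [ht]
    rw [integral_congr_ae this, integral_inner (w - C).integrable c, integral_Icc_eq_integral_Ioc,
      ← intervalIntegral.integral_of_le hab.le, ← primitiveL_apply hab (w - C) ⟨b, hb⟩, hk,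
      inner_zero_right]
  have hzero : w - C = 0 := by
    rw [← inner_self_eq_zero (𝕜 := ℝ)]
    nth_rewrite 1 [sub_eq_add_neg]
    rw [inner_add_left, inner_neg_left, h _ hk, hCk, neg_zero, add_zero]
  refine ⟨c, ?_⟩
  rw [sub_eq_zero.1 hzero]
  exact hC

/-- The Euler–Lagrange equation in integrated form. -/
theorem velocity_ae_eq_of_minimal {m : ℝ} (hm : 0 < m) {V : Eu n → ℝ} (hab : a < b)
    (hV : ContDiff ℝ 2 V) {p : Eu n × Vel a b n}
    (hp : ∀ k : Vel a b n, primitiveL hab n k ⟨b, Set.right_mem_Icc.2 hab.le⟩ = 0 →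
      reducedAction m V hab p ≤ reducedAction m V hab (p.1, p.2 + k)) :
    ∃ c : Eu n, p.2 =ᵐ[volume.restrict (Set.Icc a b)] fun t =>
      m⁻¹ • (c + ∫ u in t..b, gradient V (Set.IccExtend hab.le (pathOf hab p) u)) := by
  set N : ℝ → Eu n := fun u => gradient V (Set.IccExtend hab.le (pathOf hab p) u)
  have hN : Continuous N :=
    (continuous_gradient hV).comp (ContinuousMap.continuous _).Icc_extend'
  set R : ℝ → Eu n := fun t => ∫ u in t..b, N u
  have hR : Continuous R := by
    have : R = fun t => -∫ u in b..t, N u := by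
      funext t; exact intervalIntegral.integral_symm _ _
    rw [this]
    exact (intervalIntegral.continuous_primitive (fun _ _ => hN.intervalIntegrable _ _) b).neg
  have hRm : MemLp R 2 (volume.restrict (Set.Icc a b)) :=
    (memLp_two_iff_integrable_sq_norm hR.aestronglyMeasurable).2
      ((hR.norm.pow 2).continuousOn.integrableOn_compact isCompact_Icc)
  have hRae : hRm.toLp R =ᵐ[volume.restrict (Set.Icc a b)] R := hRm.coeFn_toLp
  obtain ⟨c, hc⟩ := ae_eq_const_of_inner_eq_zero hab (m • p.2 - hRm.toLp R) fun k hk => by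
    have hmin : IsLocalMin (fun s : ℝ => reducedAction m V hab (p.1, p.2 + s • k)) 0 :=
      Filter.Eventually.of_forall fun s => by
        simpa using hp (s • k) (by rw [map_smul, ContinuousMap.smul_apply, hk, smul_zero])
    have hd := hmin.hasDerivAt_eq_zero (hasDerivAt_reducedAction m hab hV p k)
    have hfub := integral_inner_primitive hab hN k.integrable
    have hpot : ∫ t in Set.Icc a b,
        inner ℝ (gradient V (pev (pathOf hab p) t)) (pev (primitiveL hab n k) t)
        = ∫ t in Set.Icc a b, inner ℝ (N t) (∫ u in a..t, k u) := by
      refine setIntegral_congr_fun measurableSet_Icc fun t ht => ?_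
      simp only [N, pev_eq_IccExtend hab (pathOf hab p) ht]
      rw [pev, dif_pos ht, primitiveL_apply]
    have hRk : inner ℝ (hRm.toLp R) k = ∫ s in Set.Icc a b, inner ℝ (R s) (k s) := by
      rw [L2.inner_def]
      refine integral_congr_ae ?_
      filter_upwards [hRae] with s hs
      rw [hs]
    rw [inner_sub_left, real_inner_smul_left, hRk, ← hfub, ← hpot, hd]
  refine ⟨c, ?_⟩
  filter_upwards [hc, hRae, Lp.coeFn_sub (m • p.2) (hRm.toLp R), Lp.coeFn_smul m p.2]
    with t h1 h2 h3 h4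
  rw [h3, Pi.sub_apply, h4, Pi.smul_apply, h2, sub_eq_iff_eq_add] at h1
  rw [← h1, smul_smul, inv_mul_cancel₀ hm.ne', one_smul]

end FirstVariation

/-- Curves satisfying the integrated Euler–Lagrange equation belong to the Newton flow. -/
theorem pathOf_mem_range_of_velocity_ae_eq {a b : ℝ} {n : ℕ} {m : ℝ} (hm : 0 < m)
    {V : Eu n → ℝ} (hab : a < b) (hV : ContDiff ℝ 2 V) {Φ : Eu n × Eu n → CPath a b n}
    (hΦ : IsNewtonFlow m V a b Φ) {p : Eu n × Vel a b n} {c : Eu n}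
    (hc : p.2 =ᵐ[volume.restrict (Set.Icc a b)] fun t =>
      m⁻¹ • (c + ∫ u in t..b, gradient V (Set.IccExtend hab.le (pathOf hab p) u))) :
    pathOf hab p ∈ Set.range Φ := by
  have ha : a ∈ Set.Icc a b := Set.left_mem_Icc.2 hab.le
  set N : ℝ → Eu n := fun u => gradient V (Set.IccExtend hab.le (pathOf hab p) u) with hNdef
  have hN : Continuous N :=
    (continuous_gradient hV).comp (ContinuousMap.continuous _).Icc_extend'
  set q : ℝ → Eu n := fun t => m⁻¹ • (c + ∫ u in t..b, N u)
  have hq : ∀ t, HasDerivAt q (-(m⁻¹ • N t)) t := fun t => by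
    have h := ((intervalIntegral.integral_hasDerivAt_left (hN.intervalIntegrable t b)
      (hN.stronglyMeasurableAtFilter _ _) hN.continuousAt).const_add c).const_smul m⁻¹
    rwa [smul_neg] at h
  have hqc : Continuous q := continuous_iff_continuousAt.2 fun t => (hq t).continuousAt
  set y : ℝ → Eu n := fun t => p.1 + ∫ u in a..t, q u
  have hy : ∀ t, HasDerivAt y (q t) t := fun t =>
    (intervalIntegral.integral_hasDerivAt_right (hqc.intervalIntegrable a t)
      (hqc.stronglyMeasurableAtFilter _ _) hqc.continuousAt).const_add p.1
  have hyc : Continuous y := continuous_iff_continuousAt.2 fun t => (hy t).continuousAt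
  have hyp : ∀ t (ht : t ∈ Set.Icc a b), pathOf hab p ⟨t, ht⟩ = y t := fun t ht => by
    rw [pathOf_apply, intervalIntegral_congr_ae_Icc hc ha ht]
  have hNy : ∀ t ∈ Set.Icc a b, N t = gradient V (y t) := fun t ht => by
    rw [hNdef, ← hyp t ht]
    simp only [Set.IccExtend_of_mem hab.le (pathOf hab p) ht]
  obtain ⟨f, hf, hΦf, hfa, hfa', hfode⟩ := hΦ.2 p.1 (q a)
  have hf1 : ∀ t, HasDerivAt f (deriv f t) t := fun t =>
    ((hf.differentiable (by norm_num)) t).hasDerivAt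
  have hfd : ContDiff ℝ 1 (deriv f) := hf.deriv'
  have hf2 : ∀ t, HasDerivAt (deriv f) (deriv (deriv f) t) t := fun t =>
    ((hfd.differentiable (by norm_num)) t).hasDerivAt
  obtain ⟨R₁, hR₁⟩ := isCompact_Icc.exists_bound_of_continuousOn (hyc.continuousOn (s := Set.Icc a b))
  obtain ⟨R₂, hR₂⟩ :=
    isCompact_Icc.exists_bound_of_continuousOn (hf.continuous.continuousOn (s := Set.Icc a b))
  set R := max R₁ R₂
  obtain ⟨K, hK⟩ := exists_lipschitzOnWith_gradient hV R
  set v : Eu n × Eu n → Eu n × Eu n := fun z => (z.2, -(m⁻¹ • gradient V z.1))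
  have hv : ∃ K', LipschitzOnWith K' v (Metric.closedBall 0 R ×ˢ Set.univ) := by
    have h1 : LipschitzOnWith (K * 1) (fun z : Eu n × Eu n => gradient V z.1)
        (Metric.closedBall 0 R ×ˢ Set.univ) :=
      hK.comp LipschitzWith.prod_fst.lipschitzOnWith fun z hz => hz.1
    have h2 : LipschitzWith ‖-m⁻¹‖₊ fun x : Eu n => (-m⁻¹) • x := lipschitzWith_smul _
    have h3 := h2.comp_lipschitzOnWith h1
    simp only [Function.comp_def, neg_smul] at h3
    exact ⟨_, LipschitzWith.prod_snd.lipschitzOnWith.prodMk h3⟩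
  obtain ⟨K', hK'⟩ := hv
  have huniq := ODE_solution_unique_of_mem_Icc_right (v := fun _ => v)
    (s := fun _ => Metric.closedBall 0 R ×ˢ Set.univ) (f := fun t => (y t, q t))
    (g := fun t => (f t, deriv f t)) (a := a) (b := b) (fun _ _ => hK')
    (hyc.prodMk hqc).continuousOn
    (fun t ht => by
      have h := ((hy t).prodMk (hq t)).hasDerivWithinAt (s := Set.Ici t)
      rwa [hNy t ⟨ht.1, ht.2.le⟩] at h)
    (fun t ht => ⟨mem_closedBall_zero_iff.2 ((hR₁ t ⟨ht.1, ht.2.le⟩).trans (le_max_left _ _)),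
      trivial⟩)
    (hf.continuous.prodMk hfd.continuous).continuousOn
    (fun t ht => by
      have h := ((hf1 t).prodMk (hf2 t)).hasDerivWithinAt (s := Set.Ici t)
      have h' : deriv (deriv f) t = -(m⁻¹ • gradient V (f t)) := by
        rw [← smul_neg, ← hfode t ⟨ht.1, ht.2.le⟩, smul_smul, inv_mul_cancel₀ hm.ne', one_smul]
      rwa [h'] at h)
    (fun t ht => ⟨mem_closedBall_zero_iff.2 ((hR₂ t ⟨ht.1, ht.2.le⟩).trans (le_max_right _ _)),
      trivial⟩)
    (by simp [y, hfa, hfa'])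
  refine ⟨(p.1, q a), ?_⟩
  ext1 t
  rw [hΦf t, hyp t t.2]
  exact (congrArg Prod.fst (huniq t.2)).symm

theorem IsNewtonFlow.injective {a b : ℝ} {n : ℕ} {m : ℝ} {V : Eu n → ℝ} (hab : a < b)
    {Φ : Eu n × Eu n → CPath a b n} (hΦ : IsNewtonFlow m V a b Φ) : Function.Injective Φ := by
  rintro ⟨x, v⟩ ⟨x', v'⟩ h
  have ha : a ∈ Set.Icc a b := Set.left_mem_Icc.2 hab.le
  obtain ⟨f, hf, hΦf, rfl, rfl, -⟩ := hΦ.2 x v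
  obtain ⟨g, hg, hΦg, rfl, rfl, -⟩ := hΦ.2 x' v'
  have hfg : Set.EqOn f g (Set.Icc a b) := fun t ht => by
    rw [← hΦf ⟨t, ht⟩, ← hΦg ⟨t, ht⟩, h]
  have hu := uniqueDiffOn_Icc hab a ha
  refine Prod.ext (hfg ha) ?_
  rw [← ((hf.differentiable (by norm_num)) a).derivWithin hu,
    ← ((hg.differentiable (by norm_num)) a).derivWithin hu]
  exact derivWithin_congr hfg (hfg ha)

end

/-- **Minimizers follow the Euler–Lagrange flow (Theorem 3.4(ii)).**
For the Lagrangian `L(x,v) = (m/2)|v|² − V(x)` with `V` smooth and bounded, any minimizer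
`π` of `𝔸_{μ_a,μ_b}` with finite value is the pushforward `Φ#η` of some Borel probability
measure `η` on `ℝⁿ × ℝⁿ` under the Euler–Lagrange (Newton) flow map `Φ`. -/
theorem minimizers_follow_euler_lagrange_flow
    {n : ℕ} (hn : 1 ≤ n) {a b : ℝ} (hab : a < b)
    (m : ℝ) (hm : 0 < m) (V : Eu n → ℝ)
    (hV1 : ContDiff ℝ (⊤ : ℕ∞) V) (hV2 : ∃ CV : ℝ, ∀ x, |V x| ≤ CV)
    (L : Eu n → Eu n → ℝ) (hL : ∀ x v : Eu n, L x v = m / 2 * ‖v‖ ^ 2 - V x)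
    (Φ : Eu n × Eu n → CPath a b n) (hΦ : IsNewtonFlow m V a b Φ)
    (μa μb : Measure (Eu n)) [IsProbabilityMeasure μa] [IsProbabilityMeasure μb]
    (hμaC : ∃ K : Set (Eu n), IsCompact K ∧ μa K = 1)
    (hμbC : ∃ K : Set (Eu n), IsCompact K ∧ μb K = 1)
    (hμaAC : μa ≪ volume) (hμbAC : μb ≪ volume)
    (π : Measure (CPath a b n)) [IsProbabilityMeasure π]
    (hmin : ∀ π' : Measure (CPath a b n), IsProbabilityMeasure π' →
      aFun (action L a b) μa μb π ≤ aFun (action L a b) μa μb π')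
    (hfin : aFun (action L a b) μa μb π < ⊤) :
    ∃ η : Measure (Eu n × Eu n), IsProbabilityMeasure η ∧ π = Measure.map Φ η := by
  obtain ⟨C, hC⟩ := hV2
  have hV : ContDiff ℝ 2 V := contDiff_infty.1 hV1 2
  obtain ⟨ρ, rfl, hρ⟩ := exists_map_pathOf_ae_minimal hab hm hV.continuous hC hL hmin hfin
  have hJ := measurableEmbedding_pathOf (n := n) hab
  have hΦe : MeasurableEmbedding Φ := hΦ.1.measurableEmbedding (hΦ.injective hab)
  have hrange : ∀ᵐ γ ∂ρ.map (pathOf hab), γ ∈ Set.range Φ := by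
    refine (ae_map_iff hJ.measurable.aemeasurable hΦe.measurableSet_range).2 ?_
    filter_upwards [hρ] with p hp
    obtain ⟨c, hc⟩ := velocity_ae_eq_of_minimal hm hab hV hp
    exact pathOf_mem_range_of_velocity_ae_eq hm hab hV hΦ hc
  have hη : ((ρ.map (pathOf hab)).comap Φ).map Φ = ρ.map (pathOf hab) := by
    rw [hΦe.map_comap]
    exact Measure.restrict_eq_self_of_ae_mem hrange
  refine ⟨(ρ.map (pathOf hab)).comap Φ, ?_, hη.symm⟩
  have : IsProbabilityMeasure (((ρ.map (pathOf hab)).comap Φ).map Φ) := by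
    rw [hη]; infer_instance
  exact Measure.isProbabilityMeasure_of_map Φ
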